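/- A subgroup H of PL₊(I) is non-solvable if and only if H admits towers of arbitrarily large finite height. -/

import Mathlib

/-- The support of a map of the line: points it moves. -/
def Supp (f : ℝ → ℝ) : Set ℝ := {x | f x ≠ x}

/-- `A` is an orbital of `f`: a connected component of the support of `f`. -/
def IsOrbital (f : ℝ → ℝ) (A : Set ℝ) : Prop :=
  ∃ x ∈ Supp f, A = connectedComponentIn (Supp f) x

/-- An orientation-preserving homeomorphism of `[0,1]`, encoded as a strictly
increasing bijection of `ℝ` fixing every point outside `(0,1)`. -/
def Homeo01 (f : Equiv.Perm ℝ) : Prop :=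
  StrictMono f ∧ ∀ x ∉ Set.Ioo (0:ℝ) 1, f x = x

/-- `f` is affine in a neighbourhood of `x`. -/
def LocallyAffineAt (f : ℝ → ℝ) (x : ℝ) : Prop :=
  ∃ ε > 0, ∃ m b : ℝ, ∀ y : ℝ, |y - x| < ε → f y = m * y + b

/-- Piecewise linear with finitely many breakpoints. -/
def IsPL (f : ℝ → ℝ) : Prop := {x | ¬ LocallyAffineAt f x}.Finite

/-- Membership in `PL₊(I)`. -/
def PLHomeo (f : Equiv.Perm ℝ) : Prop := Homeo01 f ∧ IsPL f

/-- Support of the action of a subgroup. -/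
def GSupp (G : Subgroup (Equiv.Perm ℝ)) : Set ℝ := {x | ∃ g ∈ G, g x ≠ x}

/-- An orbital of a subgroup: a component of the support of its action. -/
def IsGroupOrbital (G : Subgroup (Equiv.Perm ℝ)) (A : Set ℝ) : Prop :=
  ∃ x ∈ GSupp G, A = connectedComponentIn (GSupp G) x

/-- `b` is a breakpoint of `f`: one-sided derivatives exist but differ. -/
def Breakpoint (f : ℝ → ℝ) (b : ℝ) : Prop :=
  b ∈ Set.Ioo (0:ℝ) 1 ∧
  DifferentiableWithinAt ℝ f (Set.Iio b) b ∧
  DifferentiableWithinAt ℝ f (Set.Ioi b) b ∧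
  derivWithin f (Set.Iio b) b ≠ derivWithin f (Set.Ioi b) b

/-- `G` admits a transition chain of length two. -/
def HasTransitionChain2 (G : Subgroup (Equiv.Perm ℝ)) : Prop :=
  ∃ g ∈ G, ∃ h ∈ G, ∃ a₁ b₁ a₂ b₂ : ℝ,
    IsOrbital g (Set.Ioo a₁ a₂) ∧ IsOrbital h (Set.Ioo b₁ b₂) ∧
    a₁ < b₁ ∧ b₁ < a₂ ∧ a₂ < b₂

/-- A tower of the subgroup `G`: a set of signed orbitals `(A, g)` whose orbitals
form a chain under inclusion, with exactly one signature per orbital. -/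
def IsTower (G : Subgroup (Equiv.Perm ℝ)) (T : Set (Set ℝ × Equiv.Perm ℝ)) : Prop :=
  (∀ p ∈ T, p.2 ∈ G ∧ IsOrbital p.2 p.1) ∧
  (∀ p ∈ T, ∀ q ∈ T, p.1 ⊆ q.1 ∨ q.1 ⊆ p.1) ∧
  (∀ p ∈ T, ∀ q ∈ T, p.1 = q.1 → p = q)

/-- The depth of `G` equals `n`: there is a tower of height `n` and every tower
is finite with height at most `n`. -/
def DepthEq (G : Subgroup (Equiv.Perm ℝ)) (n : ℕ) : Prop :=
  (∃ T, IsTower G T ∧ T.Finite ∧ T.ncard = n) ∧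
  ∀ T, IsTower G T → T.Finite ∧ T.ncard ≤ n

open Set Filter Topology commutatorElement

/-! ### Order and topology of the line -/

/-- The complement of a closed set decomposes into gaps. -/
lemma exists_gap {C : Set ℝ} (hC : IsClosed C) {x u v : ℝ} (hx : x ∉ C) (hu : u ∈ C) (hux : u ≤ x)
    (hv : v ∈ C) (hxv : x ≤ v) :
    ∃ a b, a ∈ C ∧ b ∈ C ∧ a < x ∧ x < b ∧ ∀ y, a < y → y < b → y ∉ C := by
  have h1 : sSup (C ∩ Iic x) ∈ C ∩ Iic x :=
    (hC.inter isClosed_Iic).csSup_mem ⟨u, hu, hux⟩ ⟨x, fun y hy => hy.2⟩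
  have h2 : sInf (C ∩ Ici x) ∈ C ∩ Ici x :=
    (hC.inter isClosed_Ici).csInf_mem ⟨v, hv, hxv⟩ ⟨x, fun y hy => hy.2⟩
  refine ⟨_, _, h1.1, h2.1, lt_of_le_of_ne h1.2 fun h => hx (h ▸ h1.1),
    lt_of_le_of_ne h2.2 fun h => hx (h ▸ h2.1), fun y hy1 hy2 hyC => ?_⟩
  rcases le_total y x with h | h
  · exact absurd (le_csSup ⟨x, fun y hy => hy.2⟩ (⟨hyC, h⟩ : y ∈ C ∩ Iic x)) (not_le.2 hy1)
  · exact absurd (csInf_le ⟨x, fun y hy => hy.2⟩ (⟨hyC, h⟩ : y ∈ C ∩ Ici x)) (not_le.2 hy2)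

lemma perm_continuous {f : Equiv.Perm ℝ} (hf : StrictMono f) : Continuous f :=
  hf.monotone.continuous_of_surjective f.surjective

lemma perm_apply_inv (f : Equiv.Perm ℝ) (x : ℝ) : f (f⁻¹ x) = x := f.apply_symm_apply x

lemma perm_inv_apply (f : Equiv.Perm ℝ) (x : ℝ) : f⁻¹ (f x) = x := f.symm_apply_apply x

lemma strictMono_inv {f : Equiv.Perm ℝ} (hf : StrictMono f) : StrictMono ⇑f⁻¹ := by
  intro x y hxy
  by_contra h
  have := hf.monotone (not_lt.1 h)
  rw [perm_apply_inv, perm_apply_inv] at this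
  exact absurd hxy (not_lt.2 this)

lemma inv_fix {f : Equiv.Perm ℝ} {x : ℝ} (h : f x = x) : f⁻¹ x = x := by
  rw [Equiv.Perm.inv_eq_iff_eq, h]

/-! ### Orbitals as open intervals -/

/-- The interval `(a, b)` is an orbital of `g`. -/
def OrbIoo (g : Equiv.Perm ℝ) (a b : ℝ) : Prop :=
  a < b ∧ g a = a ∧ g b = b ∧ ∀ x, a < x → x < b → g x ≠ x

lemma OrbIoo.component_eq {g : Equiv.Perm ℝ} {a b x : ℝ} (h : OrbIoo g a b) (hax : a < x)
    (hxb : x < b) : connectedComponentIn (Supp g) x = Ioo a b := by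
  obtain ⟨-, ha, hb, hm⟩ := h
  have hx : x ∈ Supp g := hm x hax hxb
  have hoc := (isPreconnected_connectedComponentIn (F := Supp g) (x := x)).ordConnected
  have hxm := mem_connectedComponentIn hx
  have hsub := connectedComponentIn_subset (Supp g) x
  refine Subset.antisymm (fun y hy => ⟨?_, ?_⟩) ?_
  · by_contra hya
    exact hsub (hoc.out hy hxm ⟨not_lt.1 hya, hax.le⟩) ha
  · by_contra hyb
    exact hsub (hoc.out hxm hy ⟨hxb.le, not_lt.1 hyb⟩) hb
  · exact isPreconnected_Ioo.subset_connectedComponentIn ⟨hax, hxb⟩ fun y hy => hm y hy.1 hy.2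

lemma exists_orbIoo {g : Equiv.Perm ℝ} (hg : Homeo01 g) {x : ℝ} (hx : g x ≠ x) :
    ∃ a b, a < x ∧ x < b ∧ OrbIoo g a b := by
  have hx01 : x ∈ Ioo (0:ℝ) 1 := by
    by_contra h
    exact hx (hg.2 x h)
  obtain ⟨a, b, ha, hb, hax, hxb, h⟩ := exists_gap (C := {y | g y = y})
    (isClosed_eq (perm_continuous hg.1) continuous_id) hx (hg.2 0 (by simp)) hx01.1.le
    (hg.2 1 (by simp)) hx01.2.le
  exact ⟨a, b, hax, hxb, hax.trans hxb, ha, hb, h⟩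

lemma OrbIoo.isOrbital {g : Equiv.Perm ℝ} {a b : ℝ} (h : OrbIoo g a b) :
    IsOrbital g (Ioo a b) := by
  obtain ⟨x, h1, h2⟩ := exists_between h.1
  exact ⟨x, h.2.2.2 x h1 h2, (h.component_eq h1 h2).symm⟩

lemma IsOrbital.exists_orbIoo {g : Equiv.Perm ℝ} (hg : Homeo01 g) {A : Set ℝ}
    (h : IsOrbital g A) : ∃ a b, OrbIoo g a b ∧ A = Ioo a b := by
  obtain ⟨x, hx, rfl⟩ := h
  obtain ⟨a, b, h1, h2, h3⟩ := _root_.exists_orbIoo hg hx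
  exact ⟨a, b, h3, h3.component_eq h1 h2⟩

lemma OrbIoo.mem_Ioo {g : Equiv.Perm ℝ} (hg : StrictMono g) {a b x : ℝ} (h : OrbIoo g a b)
    (hax : a < x) (hxb : x < b) : a < g x ∧ g x < b := by
  constructor
  · simpa [h.2.1] using hg hax
  · simpa [h.2.2.1] using hg hxb

/-! ### Germs of piecewise linear maps -/

lemma affine_on_Ioo {f : ℝ → ℝ} {u v : ℝ} (h : ∀ x ∈ Ioo u v, LocallyAffineAt f x) :
    ∃ m b, ∀ y ∈ Ioo u v, f y = m * y + b := by
  have key : ∀ x ∈ Ioo u v, ∃ m b, f =ᶠ[𝓝 x] fun y => m * y + b := by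
    intro x hx
    obtain ⟨ε, hε, m, b, hm⟩ := h x hx
    refine ⟨m, b, ?_⟩
    filter_upwards [Metric.ball_mem_nhds x hε] with y hy
    exact hm y (by simpa [Real.dist_eq] using hy)
  have hlin : ∀ m b x : ℝ, HasDerivAt (fun y : ℝ => m * y + b) m x := by
    intro m b x
    simpa using ((hasDerivAt_id x).const_mul m).add_const b
  have hdf : ∀ x ∈ Ioo u v, DifferentiableAt ℝ f x := by
    intro x hx
    obtain ⟨m, b, hm⟩ := key x hx
    exact hm.differentiableAt_iff.2 (hlin m b x).differentiableAt
  have hdd : ∀ x ∈ Ioo u v, HasDerivAt (deriv f) 0 x := by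
    intro x hx
    obtain ⟨m, b, hm⟩ := key x hx
    have : deriv f =ᶠ[𝓝 x] fun _ => m := by
      filter_upwards [hm.deriv] with y hy
      rw [hy, (hlin m b y).deriv]
    exact (hasDerivAt_const x m).congr_of_eventuallyEq this
  obtain ⟨m, hm⟩ := isOpen_Ioo.exists_is_const_of_deriv_eq_zero isPreconnected_Ioo
    (fun x hx => (hdd x hx).differentiableAt.differentiableWithinAt)
    (fun x hx => (hdd x hx).deriv)
  have hd2 : ∀ x ∈ Ioo u v, HasDerivAt (fun y => f y - m * y) 0 x := by
    intro x hx
    have := (hdf x hx).hasDerivAt.fun_sub ((hasDerivAt_id x).const_mul m)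
    simpa [hm x hx] using this
  obtain ⟨b, hb⟩ := isOpen_Ioo.exists_is_const_of_deriv_eq_zero isPreconnected_Ioo
    (fun x hx => (hd2 x hx).differentiableAt.differentiableWithinAt)
    (fun x hx => (hd2 x hx).deriv)
  exact ⟨m, b, fun y hy => by linarith [hb y hy]⟩

lemma IsPL.exists_punctured {f : ℝ → ℝ} (hf : IsPL f) (a : ℝ) :
    ∃ ε > 0, ∀ y, |y - a| < ε → y ≠ a → LocallyAffineAt f y := by
  have hfin : ({x | ¬ LocallyAffineAt f x} \ {a}).Finite := hf.subset sdiff_subset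
  have := hfin.isClosed.isOpen_compl.mem_nhds (x := a) (by simp)
  obtain ⟨ε, hε, h⟩ := Metric.mem_nhds_iff.1 this
  refine ⟨ε, hε, fun y hy hya => ?_⟩
  by_contra hc
  exact h (show y ∈ Metric.ball a ε by simpa [Real.dist_eq] using hy) ⟨hc, hya⟩

/-- Linear germ at a fixed point, along a one-sided neighbourhood filter. -/
lemma germ_linear_of_affine {f : ℝ → ℝ} (hf : Continuous f) {a m b : ℝ} (ha : f a = a)
    {l : Filter ℝ} [l.NeBot] (hl : l ≤ 𝓝 a) (h : ∀ᶠ y in l, f y = m * y + b) :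
    ∀ᶠ y in l, f y = a + m * (y - a) := by
  have t1 : Tendsto f l (𝓝 a) := by
    have := (hf.tendsto a).mono_left hl
    rwa [ha] at this
  have t2 : Tendsto (fun y => m * y + b) l (𝓝 (m * a + b)) :=
    ((by fun_prop : Continuous fun y : ℝ => m * y + b).tendsto a).mono_left hl
  have := tendsto_nhds_unique (t1.congr' h) t2
  filter_upwards [h] with y hy
  rw [hy]
  linear_combination -this

lemma PLHomeo.germ_right {f : Equiv.Perm ℝ} (hf : PLHomeo f) {a : ℝ} (ha : f a = a) :
    ∃ m, ∀ᶠ y in 𝓝[>] a, f y = a + m * (y - a) := by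
  obtain ⟨ε, hε, h⟩ := hf.2.exists_punctured a
  obtain ⟨m, b, hm⟩ := affine_on_Ioo (f := f) (u := a) (v := a + ε) fun x hx =>
    h x (by rw [abs_lt]; constructor <;> linarith [hx.1, hx.2]) hx.1.ne'
  exact ⟨m, germ_linear_of_affine (perm_continuous hf.1.1) ha nhdsWithin_le_nhds
    (eventually_of_mem (Ioo_mem_nhdsGT (by linarith)) hm)⟩

lemma PLHomeo.germ_left {f : Equiv.Perm ℝ} (hf : PLHomeo f) {a : ℝ} (ha : f a = a) :
    ∃ m, ∀ᶠ y in 𝓝[<] a, f y = a + m * (y - a) := by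
  obtain ⟨ε, hε, h⟩ := hf.2.exists_punctured a
  obtain ⟨m, b, hm⟩ := affine_on_Ioo (f := f) (u := a - ε) (v := a) fun x hx =>
    h x (by rw [abs_lt]; constructor <;> linarith [hx.1, hx.2]) hx.2.ne
  exact ⟨m, germ_linear_of_affine (perm_continuous hf.1.1) ha nhdsWithin_le_nhds
    (eventually_of_mem (Ioo_mem_nhdsLT (by linarith)) hm)⟩

lemma tendsto_nhdsGT_of_fix {f : Equiv.Perm ℝ} (hf : StrictMono f) {a : ℝ} (ha : f a = a) :
    Tendsto f (𝓝[>] a) (𝓝[>] a) := by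
  refine tendsto_nhdsWithin_iff.2 ⟨?_, ?_⟩
  · have := ((perm_continuous hf).tendsto a).mono_left (nhdsWithin_le_nhds (s := Ioi a))
    rwa [ha] at this
  · filter_upwards [self_mem_nhdsWithin] with y hy
    simpa [ha] using hf hy

lemma tendsto_nhdsLT_of_fix {f : Equiv.Perm ℝ} (hf : StrictMono f) {a : ℝ} (ha : f a = a) :
    Tendsto f (𝓝[<] a) (𝓝[<] a) := by
  refine tendsto_nhdsWithin_iff.2 ⟨?_, ?_⟩
  · have := ((perm_continuous hf).tendsto a).mono_left (nhdsWithin_le_nhds (s := Iio a))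
    rwa [ha] at this
  · filter_upwards [self_mem_nhdsWithin] with y hy
    simpa [ha] using hf hy

/-- The permutations that are the identity along the filter `l`. -/
def trivialGerm (l : Filter ℝ) : Subgroup (Equiv.Perm ℝ) where
  carrier := {f | ∀ᶠ y in l, f y = y}
  mul_mem' := by
    intro f g hf hg
    simp only [mem_ofPred_eq] at *
    filter_upwards [hf, hg] with y h1 h2
    rw [Equiv.Perm.mul_apply, h2, h1]
  one_mem' := by simp
  inv_mem' := by
    intro f hf
    simp only [mem_ofPred_eq] at *
    filter_upwards [hf] with y h using inv_fix h

lemma mem_trivialGerm {l : Filter ℝ} {f : Equiv.Perm ℝ} :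
    f ∈ trivialGerm l ↔ ∀ᶠ y in l, f y = y := Iff.rfl

lemma commutator_le_trivialGerm {G : Subgroup (Equiv.Perm ℝ)} {l : Filter ℝ} {a : ℝ}
    (ht : ∀ f ∈ G, Tendsto f l l)
    (hlin : ∀ f ∈ G, ∃ m, ∀ᶠ y in l, f y = a + m * (y - a)) :
    ⁅G, G⁆ ≤ trivialGerm l := by
  rw [Subgroup.commutator_le]
  intro f hf g hg
  obtain ⟨m, hm⟩ := hlin f hf
  obtain ⟨n, hn⟩ := hlin g hg
  have hcomm : ∀ᶠ y in l, f (g y) = g (f y) := by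
    filter_upwards [hm, hn, (ht f hf).eventually hn, (ht g hg).eventually hm] with y h1 h2 h3 h4
    rw [h4, h3, h1, h2]
    ring
  have := (ht _ (G.inv_mem (G.mul_mem hg hf))).eventually hcomm
  rw [mem_trivialGerm]
  filter_upwards [this] with y hy
  have e : ⁅f, g⁆ y = f (g ((g * f)⁻¹ y)) := by
    simp [commutatorElement_def, Equiv.Perm.mul_apply]
  rw [e, hy, ← Equiv.Perm.mul_apply, perm_apply_inv]

lemma PLHomeo.orbIoo_right {f : Equiv.Perm ℝ} (hf : PLHomeo f) {a : ℝ} (ha : f a = a)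
    (hn : f ∉ trivialGerm (𝓝[>] a)) : ∃ b, OrbIoo f a b := by
  obtain ⟨m, hm⟩ := hf.germ_right ha
  have hm1 : m ≠ 1 := by
    rintro rfl
    apply hn
    rw [mem_trivialGerm]
    filter_upwards [hm] with y hy
    rw [hy]; ring
  obtain ⟨u, hu, hu'⟩ := mem_nhdsGT_iff_exists_Ioo_subset.1 hm
  have hmv : ∀ y, a < y → y < u → f y ≠ y := by
    intro y h1 h2 h3
    have h4 : f y = a + m * (y - a) := hu' ⟨h1, h2⟩
    have : (m - 1) * (y - a) = 0 := by linarith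
    rcases mul_eq_zero.1 this with h | h
    · exact hm1 (by linarith)
    · linarith
  obtain ⟨y, h1, h2⟩ := exists_between (show a < u from hu)
  obtain ⟨c, d, h3, h4, h5⟩ := exists_orbIoo hf.1 (hmv y h1 h2)
  have : c = a := by
    rcases lt_trichotomy c a with h | h | h
    · exact absurd ha (h5.2.2.2 a h (h1.trans h4))
    · exact h
    · exact absurd h5.2.1 (hmv c h (h3.trans h2))
  exact ⟨d, this ▸ h5⟩

lemma PLHomeo.orbIoo_left {f : Equiv.Perm ℝ} (hf : PLHomeo f) {a : ℝ} (ha : f a = a)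
    (hn : f ∉ trivialGerm (𝓝[<] a)) : ∃ b, OrbIoo f b a := by
  obtain ⟨m, hm⟩ := hf.germ_left ha
  have hm1 : m ≠ 1 := by
    rintro rfl
    apply hn
    rw [mem_trivialGerm]
    filter_upwards [hm] with y hy
    rw [hy]; ring
  obtain ⟨u, hu, hu'⟩ := mem_nhdsLT_iff_exists_Ioo_subset.1 hm
  have hmv : ∀ y, u < y → y < a → f y ≠ y := by
    intro y h1 h2 h3
    have h4 : f y = a + m * (y - a) := hu' ⟨h1, h2⟩
    have : (m - 1) * (y - a) = 0 := by linarith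
    rcases mul_eq_zero.1 this with h | h
    · exact hm1 (by linarith)
    · linarith
  obtain ⟨y, h1, h2⟩ := exists_between (show u < a from hu)
  obtain ⟨c, d, h3, h4, h5⟩ := exists_orbIoo hf.1 (hmv y h1 h2)
  have : d = a := by
    rcases lt_trichotomy d a with h | h | h
    · exact absurd h5.2.2.1 (hmv d (h1.trans h4) h)
    · exact h
    · exact absurd ha (h5.2.2.2 a (h3.trans h2) h)
  exact ⟨c, this ▸ h5⟩

/-! ### Groups of increasing permutations -/

lemma exists_lt_apply {K : Subgroup (Equiv.Perm ℝ)} (hK : ∀ k ∈ K, StrictMono k) {p q z s : ℝ}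
    (hmv : ∀ x, p < x → x < q → ∃ k ∈ K, k x ≠ x) (hz : p < z) (hs : s < q) :
    ∃ k ∈ K, s < k z := by
  by_contra! hcon
  set O : Set ℝ := {y | ∃ k ∈ K, k z = y} with hO
  have hne : O.Nonempty := ⟨z, 1, K.one_mem, rfl⟩
  have hbd : BddAbove O := ⟨s, by rintro y ⟨k, hk, rfl⟩; exact hcon k hk⟩
  have hup : ∀ k ∈ K, k (sSup O) ≤ sSup O := by
    intro k hk
    by_contra! hlt
    have h1 : k⁻¹ (sSup O) < sSup O := by
      have := strictMono_inv (hK k hk) hlt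
      rwa [perm_inv_apply] at this
    obtain ⟨y, ⟨m, hm, rfl⟩, hy⟩ := exists_lt_of_lt_csSup hne h1
    have h2 := hK k hk hy
    rw [perm_apply_inv] at h2
    exact absurd (le_csSup hbd ⟨k * m, K.mul_mem hk hm, rfl⟩) (not_le.2 h2)
  have hzS : z ≤ sSup O := le_csSup hbd ⟨1, K.one_mem, rfl⟩
  have hSs : sSup O ≤ s := csSup_le hne (by rintro y ⟨k, hk, rfl⟩; exact hcon k hk)
  obtain ⟨k, hk, hne'⟩ := hmv _ (hz.trans_le hzS) (hSs.trans_lt hs)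
  refine hne' (le_antisymm (hup k hk) ?_)
  have := (hK k hk).monotone (hup k⁻¹ (K.inv_mem hk))
  rwa [perm_apply_inv] at this

lemma exists_apply_lt {K : Subgroup (Equiv.Perm ℝ)} (hK : ∀ k ∈ K, StrictMono k) {p q z s : ℝ}
    (hmv : ∀ x, p < x → x < q → ∃ k ∈ K, k x ≠ x) (hz : z < q) (hs : p < s) :
    ∃ k ∈ K, k z < s := by
  by_contra! hcon
  set O : Set ℝ := {y | ∃ k ∈ K, k z = y} with hO
  have hne : O.Nonempty := ⟨z, 1, K.one_mem, rfl⟩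
  have hbd : BddBelow O := ⟨s, by rintro y ⟨k, hk, rfl⟩; exact hcon k hk⟩
  have hdn : ∀ k ∈ K, sInf O ≤ k (sInf O) := by
    intro k hk
    by_contra! hlt
    have h1 : sInf O < k⁻¹ (sInf O) := by
      have := strictMono_inv (hK k hk) hlt
      rwa [perm_inv_apply] at this
    obtain ⟨y, ⟨m, hm, rfl⟩, hy⟩ := exists_lt_of_csInf_lt hne h1
    have h2 := hK k hk hy
    rw [perm_apply_inv] at h2
    exact absurd (csInf_le hbd ⟨k * m, K.mul_mem hk hm, rfl⟩) (not_le.2 h2)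
  have hzS : sInf O ≤ z := csInf_le hbd ⟨1, K.one_mem, rfl⟩
  have hSs : s ≤ sInf O := le_csInf hne (by rintro y ⟨k, hk, rfl⟩; exact hcon k hk)
  obtain ⟨k, hk, hne'⟩ := hmv _ (hs.trans_le hSs) (hzS.trans_lt hz)
  refine hne' (le_antisymm ?_ (hdn k hk))
  have := (hK k hk).monotone (hdn k⁻¹ (K.inv_mem hk))
  rwa [perm_apply_inv] at this

lemma fix_of_mem_closure {S : Set (Equiv.Perm ℝ)} {x : ℝ} (h : ∀ g ∈ S, g x = x)
    {m : Equiv.Perm ℝ} (hm : m ∈ Subgroup.closure S) : m x = x := by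
  have : Subgroup.closure S ≤ MulAction.stabilizer (Equiv.Perm ℝ) x :=
    (Subgroup.closure_le _).2 fun g hg => MulAction.mem_stabilizer_iff.2 (h g hg)
  exact MulAction.mem_stabilizer_iff.1 (this hm)

lemma fix_of_mem_zpowers {g m : Equiv.Perm ℝ} {x : ℝ} (h : g x = x)
    (hm : m ∈ Subgroup.zpowers g) : m x = x := by
  rw [Subgroup.zpowers_eq_closure] at hm
  exact fix_of_mem_closure (by simpa using h) hm

lemma OrbIoo.zpowers_moves {g : Equiv.Perm ℝ} {a b : ℝ} (h : OrbIoo g a b) :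
    ∀ x, a < x → x < b → ∃ k ∈ Subgroup.zpowers g, k x ≠ x :=
  fun x h1 h2 => ⟨g, Subgroup.mem_zpowers g, h.2.2.2 x h1 h2⟩

lemma commute_of_fix {G : Subgroup (Equiv.Perm ℝ)} {x : ℝ} (hx : ∀ k ∈ ⁅G, G⁆, k x = x)
    {k m : Equiv.Perm ℝ} (hk : k ∈ G) (hm : m ∈ G) : k (m x) = m (k x) := by
  have h := hx _ (Subgroup.commutator_mem_commutator (G.inv_mem hk) (G.inv_mem hm))
  have e : k * m = m * k * ⁅k⁻¹, m⁻¹⁆ := by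
    rw [commutatorElement_def]; group
  have := congrArg (fun f : Equiv.Perm ℝ => f x) e
  simpa only [Equiv.Perm.mul_apply, h] using this

lemma commutator_le_self (G : Subgroup (Equiv.Perm ℝ)) : ⁅G, G⁆ ≤ G :=
  Subgroup.commutator_le.2 fun _ h1 _ h2 =>
    G.mul_mem (G.mul_mem (G.mul_mem h1 h2) (G.inv_mem h1)) (G.inv_mem h2)

lemma fix_apply_of_fix {G : Subgroup (Equiv.Perm ℝ)} {x : ℝ} (hx : ∀ k ∈ ⁅G, G⁆, k x = x)
    {m : Equiv.Perm ℝ} (hm : m ∈ G) : ∀ k ∈ ⁅G, G⁆, k (m x) = m x := by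
  intro k hk
  rw [commute_of_fix hx (commutator_le_self G hk) hm, hx k hk]

lemma OrbIoo.fix_ends {g : Equiv.Perm ℝ} {a b z : ℝ} (h : OrbIoo g a b)
    (haz : a < z) (hzb : z < b) {K : Subgroup (Equiv.Perm ℝ)} (hK : ∀ k ∈ K, StrictMono k)
    (hzp : ∀ m ∈ Subgroup.zpowers g, StrictMono m)
    (hz : ∀ m ∈ Subgroup.zpowers g, ∀ k ∈ K, k (m z) = m z) :
    (∀ k ∈ K, k a = a) ∧ ∀ k ∈ K, k b = b := by
  have hb : ∀ k ∈ K, b ≤ k b := by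
    intro k hk
    by_contra! hlt
    obtain ⟨m, hm, hlt'⟩ := exists_lt_apply hzp h.zpowers_moves haz hlt
    have h1 : m z < b := by
      have := hzp m hm hzb
      rwa [fix_of_mem_zpowers h.2.2.1 hm] at this
    have h2 := hK k hk h1
    rw [hz m hm k hk] at h2
    exact lt_asymm h2 hlt'
  have ha : ∀ k ∈ K, k a ≤ a := by
    intro k hk
    by_contra! hlt
    obtain ⟨m, hm, hlt'⟩ := exists_apply_lt hzp h.zpowers_moves hzb hlt
    have h1 : a < m z := by
      have := hzp m hm haz
      rwa [fix_of_mem_zpowers h.2.1 hm] at this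
    have h2 := hK k hk h1
    rw [hz m hm k hk] at h2
    exact lt_asymm h2 hlt'
  constructor
  · intro k hk
    refine le_antisymm (ha k hk) ?_
    have := (hK k hk).monotone (ha k⁻¹ (K.inv_mem hk))
    rwa [perm_apply_inv] at this
  · intro k hk
    refine le_antisymm ?_ (hb k hk)
    have := (hK k hk).monotone (hb k⁻¹ (K.inv_mem hk))
    rwa [perm_apply_inv] at this

/-- `K` acts on `(p, q)` without global fixed points, each element being the identity near the
ends of the interval. -/
structure MovesCompactly (K : Subgroup (Equiv.Perm ℝ)) (p q : ℝ) : Prop where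
  lt : p < q
  fix_left : ∀ k ∈ K, k p = p
  fix_right : ∀ k ∈ K, k q = q
  moves : ∀ x, p < x → x < q → ∃ k ∈ K, k x ≠ x
  germ_left : K ≤ trivialGerm (𝓝[>] p)
  germ_right : K ≤ trivialGerm (𝓝[<] q)

lemma MovesCompactly.commutator {K : Subgroup (Equiv.Perm ℝ)} {p q : ℝ}
    (h : MovesCompactly K p q) (hK : ∀ k ∈ K, StrictMono k) : MovesCompactly ⁅K, K⁆ p q where
  lt := h.lt
  fix_left k hk := h.fix_left k (commutator_le_self K hk)
  fix_right k hk := h.fix_right k (commutator_le_self K hk)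
  germ_left := (commutator_le_self K).trans h.germ_left
  germ_right := (commutator_le_self K).trans h.germ_right
  moves x hpx hxq := by
    by_contra! hfix
    obtain ⟨k, hk, hkx⟩ := h.moves x hpx hxq
    obtain ⟨s, hs, hs'⟩ := mem_nhdsLT_iff_exists_Ioo_subset.1 (h.germ_right hk)
    obtain ⟨m, hm, hsm⟩ := exists_lt_apply hK h.moves hpx hs
    have h1 : m x < q := by
      have := hK m hm hxq
      rwa [h.fix_right m hm] at this
    have h2 : k (m x) = m x := hs' ⟨hsm, h1⟩
    rw [commute_of_fix hfix hk hm] at h2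
    exact hkx (m.injective h2)

lemma MovesCompactly.ne_bot {K : Subgroup (Equiv.Perm ℝ)} {p q : ℝ}
    (h : MovesCompactly K p q) : K ≠ ⊥ := by
  rintro rfl
  obtain ⟨x, h1, h2⟩ := exists_between h.lt
  obtain ⟨k, hk, hkx⟩ := h.moves x h1 h2
  rw [Subgroup.mem_bot] at hk
  exact hkx (by rw [hk]; rfl)

/-- A map permuting the fixed points of a group fixes the ends of each gap between them that it
does not move off itself. -/
lemma fix_gap_ends {F : Set ℝ} {g : Equiv.Perm ℝ} (hg : StrictMono g) {p q x : ℝ}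
    (hF : ∀ y ∈ F, g y ∈ F) (hF' : ∀ y ∈ F, g⁻¹ y ∈ F) (hp : p ∈ F) (hq : q ∈ F)
    (hgap : ∀ y, p < y → y < q → y ∉ F) (hpx : p < x) (hxq : x < q)
    (hpg : p < g x) (hgq : g x < q) : g p = p ∧ g q = q := by
  have hgi := strictMono_inv hg
  constructor
  · rcases lt_trichotomy (g p) p with h | h | h
    · have h1 := hgi h
      have h2 := hgi hpg
      rw [perm_inv_apply] at h1 h2
      exact absurd (hF' p hp) (hgap _ h1 (h2.trans hxq))
    · exact h
    · exact absurd (hF p hp) (hgap _ h ((hg hpx).trans hgq))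
  · rcases lt_trichotomy (g q) q with h | h | h
    · exact absurd (hF q hq) (hgap _ (hpg.trans (hg hxq)) h)
    · exact h
    · have h1 := hgi h
      have h2 := hgi hgq
      rw [perm_inv_apply] at h1 h2
      exact absurd (hF' q hq) (hgap _ (hpx.trans h2) h1)

lemma exists_movesCompactly {H : Subgroup (Equiv.Perm ℝ)} (hH : ∀ g ∈ H, PLHomeo g)
    {g h : Equiv.Perm ℝ} (hg : g ∈ H) (hh : h ∈ H) {a b c d x : ℝ} (A : OrbIoo g a b)
    (B : OrbIoo h c d) (hax : a < x) (hxb : x < b) (hcx : c < x) (hxd : x < d)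
    (hA : ∀ y, a < y → y < b →
      ∃ k ∈ ⁅Subgroup.closure {g, h}, Subgroup.closure {g, h}⁆, k y ≠ y)
    (hB : ∀ y, c < y → y < d →
      ∃ k ∈ ⁅Subgroup.closure {g, h}, Subgroup.closure {g, h}⁆, k y ≠ y) :
    ∃ K ≤ H, ∃ p q, MovesCompactly K p q := by
  set G := Subgroup.closure {g, h} with hG
  have hGH : G ≤ H := (Subgroup.closure_le H).2 (by
    rintro f (rfl | rfl)
    exacts [hg, hh])
  have hgG : g ∈ G := Subgroup.subset_closure (by simp)
  have hhG : h ∈ G := Subgroup.subset_closure (by simp)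
  have hKG := commutator_le_self G
  set F : Set ℝ := {y | ∀ k ∈ ⁅G, G⁆, k y = y} with hF
  have hFc : IsClosed F := by
    have : F = ⋂ k ∈ ⁅G, G⁆, {y | k y = y} := by ext; simp [hF]
    rw [this]
    exact isClosed_biInter fun k hk =>
      isClosed_eq (perm_continuous (hH k (hGH (hKG hk))).1.1) continuous_id
  have hFA : ∀ y, a < y → y < b → y ∉ F := fun y h1 h2 h3 => by
    obtain ⟨k, hk, hne⟩ := hA y h1 h2
    exact hne (h3 k hk)
  have hFB : ∀ y, c < y → y < d → y ∉ F := fun y h1 h2 h3 => by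
    obtain ⟨k, hk, hne⟩ := hB y h1 h2
    exact hne (h3 k hk)
  have hx01 : x ∈ Ioo (0:ℝ) 1 := by
    by_contra hc
    exact A.2.2.2 x hax hxb ((hH g hg).1.2 x hc)
  obtain ⟨p, q, hp, hq, hpx, hxq, hgap⟩ := exists_gap hFc (hFA x hax hxb)
    (fun k hk => (hH k (hGH (hKG hk))).1.2 0 (by simp)) hx01.1.le
    (fun k hk => (hH k (hGH (hKG hk))).1.2 1 (by simp)) hx01.2.le
  have hpa : p ≤ a := not_lt.1 fun hc => hFA p hc (hpx.trans hxb) hp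
  have hbq : b ≤ q := not_lt.1 fun hc => hFA q (hax.trans hxq) hc hq
  have hpc : p ≤ c := not_lt.1 fun hc => hFB p hc (hpx.trans hxd) hp
  have hdq : d ≤ q := not_lt.1 fun hc => hFB q (hcx.trans hxq) hc hq
  have hinv : ∀ f ∈ G, ∀ y ∈ F, f y ∈ F := fun f hf y hy => fix_apply_of_fix hy hf
  have hgx := A.mem_Ioo (hH g hg).1.1 hax hxb
  have hhx := B.mem_Ioo (hH h hh).1.1 hcx hxd
  have hgpq := fix_gap_ends (hH g hg).1.1 (hinv g hgG) (hinv _ (G.inv_mem hgG)) hp hq hgap hpx hxq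
    (hpa.trans_lt hgx.1) (hgx.2.trans_le hbq)
  have hhpq := fix_gap_ends (hH h hh).1.1 (hinv h hhG) (hinv _ (G.inv_mem hhG)) hp hq hgap hpx hxq
    (hpc.trans_lt hhx.1) (hhx.2.trans_le hdq)
  have hGp : ∀ f ∈ G, f p = p := fun f hf => fix_of_mem_closure (by
    rintro f (rfl | rfl)
    exacts [hgpq.1, hhpq.1]) hf
  have hGq : ∀ f ∈ G, f q = q := fun f hf => fix_of_mem_closure (by
    rintro f (rfl | rfl)
    exacts [hgpq.2, hhpq.2]) hf
  refine ⟨⁅G, G⁆, hKG.trans hGH, p, q, hpx.trans hxq, hp, hq, fun y h1 h2 => ?_, ?_, ?_⟩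
  · by_contra! hc
    exact hgap y h1 h2 hc
  · exact commutator_le_trivialGerm
      (fun f hf => tendsto_nhdsGT_of_fix (hH f (hGH hf)).1.1 (hGp f hf))
      (fun f hf => (hH f (hGH hf)).germ_right (hGp f hf))
  · exact commutator_le_trivialGerm
      (fun f hf => tendsto_nhdsLT_of_fix (hH f (hGH hf)).1.1 (hGq f hf))
      (fun f hf => (hH f (hGH hf)).germ_left (hGq f hf))

/-! ### Overlapping orbitals -/

lemma OrbIoo.fix_ends_of_fix {H : Subgroup (Equiv.Perm ℝ)} (hH : ∀ g ∈ H, PLHomeo g)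
    {g : Equiv.Perm ℝ} (hg : g ∈ H) {a b z : ℝ} (A : OrbIoo g a b) (haz : a < z) (hzb : z < b)
    {G : Subgroup (Equiv.Perm ℝ)} (hGH : G ≤ H) (hgG : g ∈ G)
    (hz : ∀ k ∈ ⁅G, G⁆, k z = z) : (∀ k ∈ ⁅G, G⁆, k a = a) ∧ ∀ k ∈ ⁅G, G⁆, k b = b :=
  A.fix_ends haz hzb (fun k hk => (hH k (hGH (commutator_le_self G hk))).1.1)
    (fun m hm => (hH m ((Subgroup.zpowers_le.2 hg) hm)).1.1)
    fun _ hm => fix_apply_of_fix hz ((Subgroup.zpowers_le.2 hgG) hm)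

lemma exists_movesCompactly_of_chain {H : Subgroup (Equiv.Perm ℝ)} (hH : ∀ g ∈ H, PLHomeo g)
    {g h : Equiv.Perm ℝ} (hg : g ∈ H) (hh : h ∈ H) {a b c d : ℝ} (A : OrbIoo g a b)
    (B : OrbIoo h c d) (hca : c < a) (had : a < d) (hdb : d < b) :
    ∃ K ≤ H, ∃ p q, MovesCompactly K p q := by
  obtain ⟨x, hax, hxd⟩ := exists_between had
  have hzg : ∀ m ∈ Subgroup.zpowers g, StrictMono m :=
    fun m hm => (hH m ((Subgroup.zpowers_le.2 hg) hm)).1.1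
  have hzh : ∀ m ∈ Subgroup.zpowers h, StrictMono m :=
    fun m hm => (hH m ((Subgroup.zpowers_le.2 hh) hm)).1.1
  have hGH : Subgroup.closure {g, h} ≤ H := (Subgroup.closure_le H).2 (by
    rintro f (rfl | rfl)
    exacts [hg, hh])
  have hgG : g ∈ Subgroup.closure {g, h} := Subgroup.subset_closure (by simp)
  have hhG : h ∈ Subgroup.closure {g, h} := Subgroup.subset_closure (by simp)
  refine exists_movesCompactly hH hg hh A B hax (hxd.trans hdb) (hca.trans hax) hxd ?_ ?_
  · intro y h1 h2
    by_contra! hc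
    have haF := (A.fix_ends_of_fix hH hg h1 h2 hGH hgG hc).1
    obtain ⟨m, hm, hlt⟩ := exists_lt_apply hzh B.zpowers_moves hca had
    have hmd : m a < d := by
      have := hzh m hm had
      rwa [fix_of_mem_zpowers B.2.2.1 hm] at this
    refine A.2.2.2 (m a) hlt (hmd.trans hdb) ?_
    rw [commute_of_fix haF hgG ((Subgroup.zpowers_le.2 hhG) hm), A.2.1]
  · intro y h1 h2
    by_contra! hc
    have hdF := (B.fix_ends_of_fix hH hh h1 h2 hGH hhG hc).2
    obtain ⟨m, hm, hlt⟩ := exists_apply_lt hzg A.zpowers_moves hdb had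
    have hmd : a < m d := by
      have := hzg m hm had
      rwa [fix_of_mem_zpowers A.2.1 hm] at this
    refine B.2.2.2 (m d) (hca.trans hmd) hlt ?_
    rw [commute_of_fix hdF hhG ((Subgroup.zpowers_le.2 hgG) hm), B.2.2.1]

lemma exists_movesCompactly_of_shared_left {H : Subgroup (Equiv.Perm ℝ)}
    (hH : ∀ g ∈ H, PLHomeo g) {g h : Equiv.Perm ℝ} (hg : g ∈ H) (hh : h ∈ H) {a b d : ℝ}
    (A : OrbIoo g a b) (B : OrbIoo h a d) (hbd : b < d) :
    ∃ K ≤ H, ∃ p q, MovesCompactly K p q := by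
  obtain ⟨x, hax, hxb⟩ := exists_between A.1
  have hzh : ∀ m ∈ Subgroup.zpowers h, StrictMono m :=
    fun m hm => (hH m ((Subgroup.zpowers_le.2 hh) hm)).1.1
  have hGH : Subgroup.closure {g, h} ≤ H := (Subgroup.closure_le H).2 (by
    rintro f (rfl | rfl)
    exacts [hg, hh])
  have hgG : g ∈ Subgroup.closure {g, h} := Subgroup.subset_closure (by simp)
  have hhG : h ∈ Subgroup.closure {g, h} := Subgroup.subset_closure (by simp)
  have hgt : ∀ m ∈ Subgroup.zpowers h, ∀ y, a < y → a < m y := fun m hm y hy => by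
    have := hzh m hm hy
    rwa [fix_of_mem_zpowers B.2.1 hm] at this
  have hA : ∀ y, a < y → y < b →
      ∃ k ∈ ⁅Subgroup.closure {g, h}, Subgroup.closure {g, h}⁆, k y ≠ y := by
    intro y h1 h2
    by_contra! hc
    have hbF := (A.fix_ends_of_fix hH hg h1 h2 hGH hgG hc).2
    obtain ⟨m, hm, hlt⟩ := exists_apply_lt hzh B.zpowers_moves hbd A.1
    refine A.2.2.2 (m b) (hgt m hm b A.1) hlt ?_
    rw [commute_of_fix hbF hgG ((Subgroup.zpowers_le.2 hhG) hm), A.2.2.1]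
  refine exists_movesCompactly hH hg hh A B hax hxb hax (hxb.trans hbd) hA ?_
  intro y h1 h2
  by_contra! hc
  obtain ⟨m, hm, hlt⟩ := exists_apply_lt hzh B.zpowers_moves h2 A.1
  obtain ⟨k, hk, hne⟩ := hA (m y) (hgt m hm y h1) hlt
  exact hne (fix_apply_of_fix hc ((Subgroup.zpowers_le.2 hhG) hm) k hk)

lemma exists_movesCompactly_of_shared_right {H : Subgroup (Equiv.Perm ℝ)}
    (hH : ∀ g ∈ H, PLHomeo g) {g h : Equiv.Perm ℝ} (hg : g ∈ H) (hh : h ∈ H) {a b c : ℝ}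
    (A : OrbIoo g a b) (B : OrbIoo h c b) (hca : c < a) :
    ∃ K ≤ H, ∃ p q, MovesCompactly K p q := by
  obtain ⟨x, hax, hxb⟩ := exists_between A.1
  have hzh : ∀ m ∈ Subgroup.zpowers h, StrictMono m :=
    fun m hm => (hH m ((Subgroup.zpowers_le.2 hh) hm)).1.1
  have hGH : Subgroup.closure {g, h} ≤ H := (Subgroup.closure_le H).2 (by
    rintro f (rfl | rfl)
    exacts [hg, hh])
  have hgG : g ∈ Subgroup.closure {g, h} := Subgroup.subset_closure (by simp)
  have hhG : h ∈ Subgroup.closure {g, h} := Subgroup.subset_closure (by simp)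
  have hlt' : ∀ m ∈ Subgroup.zpowers h, ∀ y, y < b → m y < b := fun m hm y hy => by
    have := hzh m hm hy
    rwa [fix_of_mem_zpowers B.2.2.1 hm] at this
  have hA : ∀ y, a < y → y < b →
      ∃ k ∈ ⁅Subgroup.closure {g, h}, Subgroup.closure {g, h}⁆, k y ≠ y := by
    intro y h1 h2
    by_contra! hc
    have haF := (A.fix_ends_of_fix hH hg h1 h2 hGH hgG hc).1
    obtain ⟨m, hm, hlt⟩ := exists_lt_apply hzh B.zpowers_moves hca A.1
    refine A.2.2.2 (m a) hlt (hlt' m hm a A.1) ?_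
    rw [commute_of_fix haF hgG ((Subgroup.zpowers_le.2 hhG) hm), A.2.1]
  refine exists_movesCompactly hH hg hh A B hax hxb (hca.trans hax) hxb hA ?_
  intro y h1 h2
  by_contra! hc
  obtain ⟨m, hm, hlt⟩ := exists_lt_apply hzh B.zpowers_moves h1 A.1
  obtain ⟨k, hk, hne⟩ := hA (m y) hlt (hlt' m hm y h2)
  exact hne (fix_apply_of_fix hc ((Subgroup.zpowers_le.2 hhG) hm) k hk)

/-- Any two overlapping orbitals of elements of `H` are equal, or one contains the closure of the
other. -/
def BalancedOrbitals (H : Subgroup (Equiv.Perm ℝ)) : Prop :=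
  ∀ g ∈ H, ∀ h ∈ H, ∀ a b c d, OrbIoo g a b → OrbIoo h c d → max a c < min b d →
    (a = c ∧ b = d) ∨ (a < c ∧ d < b) ∨ (c < a ∧ b < d)

lemma BalancedOrbitals.mono {H K : Subgroup (Equiv.Perm ℝ)} (hH : BalancedOrbitals H) (h : K ≤ H) : BalancedOrbitals K :=
  fun g hg k hk => hH g (h hg) k (h hk)

lemma balanced_or_exists_movesCompactly {H : Subgroup (Equiv.Perm ℝ)}
    (hH : ∀ g ∈ H, PLHomeo g) : BalancedOrbitals H ∨ ∃ K ≤ H, ∃ p q, MovesCompactly K p q := by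
  by_contra! hcon
  obtain ⟨hb, hn⟩ := hcon
  have hn : ¬ ∃ K ≤ H, ∃ p q, MovesCompactly K p q := by push Not; exact hn
  apply hb
  intro g hg h hh a b c d A B hov
  simp only [max_lt_iff, lt_min_iff] at hov
  rcases lt_trichotomy a c with h1 | rfl | h1 <;> rcases lt_trichotomy b d with h2 | rfl | h2
  · exact absurd (exists_movesCompactly_of_chain hH hh hg B A h1 hov.1.2 h2) hn
  · exact absurd (exists_movesCompactly_of_shared_right hH hh hg B A h1) hn
  · exact Or.inr (Or.inl ⟨h1, h2⟩)
  · exact absurd (exists_movesCompactly_of_shared_left hH hg hh A B h2) hn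
  · exact Or.inl ⟨rfl, rfl⟩
  · exact absurd (exists_movesCompactly_of_shared_left hH hh hg B A h2) hn
  · exact Or.inr (Or.inr ⟨h1, h2⟩)
  · exact absurd (exists_movesCompactly_of_shared_right hH hg hh A B h1) hn
  · exact absurd (exists_movesCompactly_of_chain hH hg hh A B h1 hov.2.1 h2) hn

/-! ### Towers as increasing sequences of intervals -/

/-- `H` has a tower of height `n` whose largest orbital is `(a, b)`. -/
inductive HasTower (H : Subgroup (Equiv.Perm ℝ)) : ℕ → ℝ → ℝ → Prop
  | single {g : Equiv.Perm ℝ} {a b : ℝ} : g ∈ H → OrbIoo g a b → HasTower H 1 a b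
  | cons {n : ℕ} {g : Equiv.Perm ℝ} {a b c d : ℝ} : HasTower H n a b → g ∈ H → OrbIoo g c d →
      c ≤ a → b ≤ d → (c < a ∨ b < d) → HasTower H (n + 1) c d

lemma HasTower.exists_orbIoo {H : Subgroup (Equiv.Perm ℝ)} {n : ℕ} {a b : ℝ}
    (h : HasTower H n a b) : ∃ g ∈ H, OrbIoo g a b := by
  cases h with
  | single hg ho => exact ⟨_, hg, ho⟩
  | cons _ hg ho => exact ⟨_, hg, ho⟩

lemma HasTower.mono {H K : Subgroup (Equiv.Perm ℝ)} (hHK : H ≤ K) {n : ℕ} {a b : ℝ}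
    (h : HasTower H n a b) : HasTower K n a b := by
  induction h with
  | single hg ho => exact .single (hHK hg) ho
  | cons _ hg ho h1 h2 h3 ih => exact .cons ih (hHK hg) ho h1 h2 h3

lemma BalancedOrbitals.fix_ends {H : Subgroup (Equiv.Perm ℝ)} (hH : ∀ g ∈ H, PLHomeo g)
    (hB : BalancedOrbitals H) {g h : Equiv.Perm ℝ} (hg : g ∈ H) (hh : h ∈ H) {a b c d : ℝ}
    (A : OrbIoo g a b) (C : OrbIoo h c d) (hca : c < a) (hbd : b < d) : g c = c ∧ g d = d := by
  have hab := A.1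
  constructor
  · by_contra hne
    obtain ⟨u, v, huc, hcv, U⟩ := _root_.exists_orbIoo (hH g hg).1 hne
    rcases hB g hg h hh u v c d U C (by
      simp only [max_lt_iff, lt_min_iff]
      exact ⟨⟨U.1, hcv⟩, huc.trans C.1, C.1⟩) with h1 | h1 | h1
    · exact huc.ne h1.1
    · exact U.2.2.2 a (huc.trans hca) (by linarith [h1.2]) A.2.1
    · exact lt_asymm huc h1.1
  · by_contra hne
    obtain ⟨u, v, hud, hdv, U⟩ := _root_.exists_orbIoo (hH g hg).1 hne
    rcases hB g hg h hh u v c d U C (by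
      simp only [max_lt_iff, lt_min_iff]
      exact ⟨⟨U.1, C.1.trans hdv⟩, hud, C.1⟩) with h1 | h1 | h1
    · exact hdv.ne' h1.2
    · exact U.2.2.2 a (by linarith [h1.1]) (by linarith [h1.2]) A.2.1
    · exact lt_asymm hdv h1.2

/-- An orbital properly contained in another one is an orbital of a commutator. -/
lemma BalancedOrbitals.exists_commutator {H : Subgroup (Equiv.Perm ℝ)} (hH : ∀ g ∈ H, PLHomeo g)
    (hB : BalancedOrbitals H) {g h : Equiv.Perm ℝ} (hg : g ∈ H) (hh : h ∈ H) {a b c d : ℝ}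
    (A : OrbIoo g a b) (C : OrbIoo h c d) (hca : c < a) (hbd : b < d) :
    ∃ w ∈ ⁅H, H⁆, OrbIoo w a b := by
  have hab := A.1
  obtain ⟨hgc, hgd⟩ := hB.fix_ends hH hg hh A C hca hbd
  have hgl : g ∈ trivialGerm (𝓝[>] c) := by
    by_contra hne
    obtain ⟨v, V⟩ := (hH g hg).orbIoo_right hgc hne
    rcases hB g hg h hh c v c d V C (by simp [V.1, C.1]) with h1 | h1 | h1
    · exact V.2.2.2 a hca (by linarith [h1.2]) A.2.1
    · exact lt_irrefl _ h1.1
    · exact lt_irrefl _ h1.1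
  have hgr : g ∈ trivialGerm (𝓝[<] d) := by
    by_contra hne
    obtain ⟨v, V⟩ := (hH g hg).orbIoo_left hgd hne
    rcases hB g hg h hh v d c d V C (by simp [V.1, C.1]) with h1 | h1 | h1
    · exact V.2.2.2 b (by linarith [h1.1]) hbd A.2.2.1
    · exact lt_irrefl _ h1.2
    · exact lt_irrefl _ h1.2
  obtain ⟨s, hs, hs'⟩ := mem_nhdsGT_iff_exists_Ioo_subset.1 hgl
  obtain ⟨t, ht, ht'⟩ := mem_nhdsLT_iff_exists_Ioo_subset.1 hgr
  replace hs : c < s := hs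
  replace ht : t < d := ht
  have hsa : s ≤ a := by
    by_contra! hc
    obtain ⟨y, h1, h2⟩ := exists_between (lt_min hab hc)
    exact A.2.2.2 y h1 (lt_min_iff.1 h2).1 (hs' ⟨hca.trans h1, (lt_min_iff.1 h2).2⟩)
  have hbt : b ≤ t := by
    by_contra! hc
    obtain ⟨y, h1, h2⟩ := exists_between (max_lt hab hc)
    exact A.2.2.2 y (max_lt_iff.1 h1).1 h2 (ht' ⟨(max_lt_iff.1 h1).2, h2.trans hbd⟩)
  have hzh : ∀ m ∈ Subgroup.zpowers h, StrictMono m :=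
    fun m hm => (hH m ((Subgroup.zpowers_le.2 hh) hm)).1.1
  obtain ⟨m, hm, hlt⟩ := exists_lt_apply hzh C.zpowers_moves hs ht
  have hmi := strictMono_inv (hzh m hm)
  have hw : ∀ x, a ≤ x → x ≤ b → ⁅g, m⁆ x = g x := by
    intro x h1 h2
    have h3 : m⁻¹ x < s := by
      have := hmi ((h2.trans hbt).trans_lt hlt)
      rwa [perm_inv_apply] at this
    have h4 : c < m⁻¹ x := by
      have := hmi (hca.trans_le h1)
      rwa [inv_fix (fix_of_mem_zpowers C.2.1 hm)] at this
    have h5 : g⁻¹ (m⁻¹ x) = m⁻¹ x := inv_fix (hs' ⟨h4, h3⟩)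
    rw [commutatorElement_def]
    simp only [Equiv.Perm.mul_apply]
    rw [h5, perm_apply_inv]
  refine ⟨⁅g, m⁆, Subgroup.commutator_mem_commutator hg ((Subgroup.zpowers_le.2 hh) hm), hab,
    ?_, ?_, fun x h1 h2 => ?_⟩
  · rw [hw a le_rfl hab.le, A.2.1]
  · rw [hw b hab.le le_rfl, A.2.2.1]
  · rw [hw x h1.le h2.le]
    exact A.2.2.2 x h1 h2

lemma BalancedOrbitals.lt_of_le {H : Subgroup (Equiv.Perm ℝ)} (hB : BalancedOrbitals H) {g h : Equiv.Perm ℝ}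
    (hg : g ∈ H) (hh : h ∈ H) {a b c d : ℝ} (A : OrbIoo g a b) (C : OrbIoo h c d)
    (hca : c ≤ a) (hbd : b ≤ d) (hlt : c < a ∨ b < d) : c < a ∧ b < d := by
  have := A.1
  rcases hB g hg h hh a b c d A C (by
    simp only [max_lt_iff, lt_min_iff]
    refine ⟨⟨?_, ?_⟩, ?_, ?_⟩ <;> linarith) with h1 | h1 | h1
  · rcases hlt with h | h <;> linarith [h1.1, h1.2]
  · linarith [h1.1]
  · exact h1

lemma HasTower.commutator {H : Subgroup (Equiv.Perm ℝ)} (hH : ∀ g ∈ H, PLHomeo g)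
    (hB : BalancedOrbitals H) {n : ℕ} {a b : ℝ} (hT : HasTower H n a b) :
    ∀ {h : Equiv.Perm ℝ} {c d : ℝ}, h ∈ H → OrbIoo h c d → c ≤ a → b ≤ d → (c < a ∨ b < d) →
      HasTower ⁅H, H⁆ n a b := by
  induction hT with
  | single hg A =>
    intro h c d hh C h1 h2 h3
    obtain ⟨h4, h5⟩ := hB.lt_of_le hg hh A C h1 h2 h3
    obtain ⟨w, hw, W⟩ := hB.exists_commutator hH hg hh A C h4 h5
    exact .single hw W
  | cons _ hg A k1 k2 k3 ih =>
    intro h c d hh C h1 h2 h3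
    obtain ⟨h4, h5⟩ := hB.lt_of_le hg hh A C h1 h2 h3
    obtain ⟨w, hw, W⟩ := hB.exists_commutator hH hg hh A C h4 h5
    exact .cons (ih hg A k1 k2 k3) hw W k1 k2 k3

lemma HasTower.exists_of_commutator {H : Subgroup (Equiv.Perm ℝ)} (hH : ∀ g ∈ H, PLHomeo g)
    (hB : BalancedOrbitals H) {n : ℕ} {a b : ℝ} (hT : HasTower ⁅H, H⁆ n a b) :
    ∃ c d, HasTower H (n + 1) c d := by
  obtain ⟨g, hg, A⟩ := hT.exists_orbIoo
  by_cases hfix : ∀ h ∈ H, h a = a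
  · have := commutator_le_trivialGerm (l := 𝓝[>] a)
      (fun f hf => tendsto_nhdsGT_of_fix (hH f hf).1.1 (hfix f hf))
      (fun f hf => (hH f hf).germ_right (hfix f hf)) hg
    obtain ⟨u, hu, hu'⟩ := mem_nhdsGT_iff_exists_Ioo_subset.1 this
    obtain ⟨y, h1, h2⟩ := exists_between (lt_min A.1 (show a < u from hu))
    exact absurd (hu' ⟨h1, (lt_min_iff.1 h2).2⟩) (A.2.2.2 y h1 (lt_min_iff.1 h2).1)
  · push Not at hfix
    obtain ⟨h, hh, hne⟩ := hfix
    obtain ⟨c, d, hca, had, C⟩ := _root_.exists_orbIoo (hH h hh).1 hne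
    have hab := A.1
    have hgH := commutator_le_self H hg
    rcases hB g hgH h hh a b c d A C (by
      simp only [max_lt_iff, lt_min_iff]
      exact ⟨⟨hab, hca.trans hab⟩, had, C.1⟩) with h1 | h1 | h1
    · exact absurd h1.1 hca.ne'
    · exact absurd h1.1 hca.not_gt
    · exact ⟨c, d, .cons (hT.mono (commutator_le_self H)) hh C h1.1.le h1.2.le (Or.inl h1.1)⟩

/-! ### The derived series -/

/-- The derived series of a subgroup, inside the ambient group. -/
def derivedIter {G : Type*} [Group G] (H : Subgroup G) : ℕ → Subgroup G
  | 0 => H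
  | n + 1 => derivedIter ⁅H, H⁆ n

lemma derivedIter_succ {G : Type*} [Group G] (H : Subgroup G) (n : ℕ) :
    derivedIter H (n + 1) = ⁅derivedIter H n, derivedIter H n⁆ := by
  induction n generalizing H with
  | zero => rfl
  | succ n ih => exact ih ⁅H, H⁆

lemma map_subtype_derivedSeries {G : Type*} [Group G] (H : Subgroup G) (n : ℕ) :
    (derivedSeries H n).map H.subtype = derivedIter H n := by
  induction n with
  | zero => simp [derivedIter, ← MonoidHom.range_eq_map]
  | succ n ih => rw [derivedSeries_succ, Subgroup.map_commutator, ih, derivedIter_succ]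

lemma isSolvable_iff_derivedIter {G : Type*} [Group G] (H : Subgroup G) :
    Group.IsSolvable H ↔ ∃ n, derivedIter H n = ⊥ := by
  rw [Group.isSolvable_def]
  refine exists_congr fun n => ?_
  rw [← map_subtype_derivedSeries, Subgroup.map_eq_bot_iff_of_injective _ H.subtype_injective]

lemma MovesCompactly.derivedIter_ne_bot {H K : Subgroup (Equiv.Perm ℝ)}
    (hH : ∀ g ∈ H, StrictMono g) (hKH : K ≤ H) {p q : ℝ} (h : MovesCompactly K p q) (n : ℕ) :
    derivedIter H n ≠ ⊥ := by
  induction n generalizing H K with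
  | zero =>
    rintro rfl
    exact h.ne_bot (le_bot_iff.1 hKH)
  | succ n ih =>
    exact ih (fun g hg => hH g (commutator_le_self H hg)) (Subgroup.commutator_mono hKH hKH)
      (h.commutator fun k hk => hH k (hKH hk))

lemma MovesCompactly.hasTower {K : Subgroup (Equiv.Perm ℝ)} (hK : ∀ g ∈ K, Homeo01 g)
    {p q : ℝ} (h : MovesCompactly K p q) (n : ℕ) :
    ∃ a b, p < a ∧ b < q ∧ HasTower K (n + 1) a b := by
  have hends : ∀ k ∈ K, ∀ x a b, p < x → x < q → a < x → x < b → OrbIoo k a b →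
      p < a ∧ b < q := by
    intro k hk x a b hpx hxq hax hxb A
    constructor
    · by_contra! hc
      obtain ⟨u, hu, hu'⟩ := mem_nhdsGT_iff_exists_Ioo_subset.1 (h.germ_left hk)
      obtain ⟨y, h1, h2⟩ := exists_between (lt_min hpx (show p < u from hu))
      rw [lt_min_iff] at h2
      exact A.2.2.2 y (hc.trans_lt h1) (h2.1.trans hxb) (hu' ⟨h1, h2.2⟩)
    · by_contra! hc
      obtain ⟨u, hu, hu'⟩ := mem_nhdsLT_iff_exists_Ioo_subset.1 (h.germ_right hk)
      obtain ⟨y, h1, h2⟩ := exists_between (max_lt hxq (show u < q from hu))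
      rw [max_lt_iff] at h1
      exact A.2.2.2 y (hax.trans h1.1) (h2.trans_le hc) (hu' ⟨h1.2, h2⟩)
  induction n with
  | zero =>
    obtain ⟨x, h1, h2⟩ := exists_between h.lt
    obtain ⟨k, hk, hne⟩ := h.moves x h1 h2
    obtain ⟨a, b, hax, hxb, A⟩ := exists_orbIoo (hK k hk) hne
    obtain ⟨h3, h4⟩ := hends k hk x a b h1 h2 hax hxb A
    exact ⟨a, b, h3, h4, .single hk A⟩
  | succ n ih =>
    obtain ⟨a, b, hpa, hbq, hT⟩ := ih
    obtain ⟨-, -, hab, -⟩ := hT.exists_orbIoo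
    obtain ⟨k, hk, hlt⟩ := exists_lt_apply (fun k hk => (hK k hk).1) h.moves hpa hbq
    obtain ⟨c, d, hca, had, C⟩ := exists_orbIoo (hK k hk) (hab.trans hlt).ne'
    have hbd : b < d := hlt.trans (C.mem_Ioo (hK k hk).1 hca had).2
    obtain ⟨h3, h4⟩ := hends k hk a c d hpa (hab.trans hbq) hca had C
    exact ⟨c, d, h3, h4, .cons hT hk C hca.le hbd.le (Or.inl hca)⟩

lemma BalancedOrbitals.hasTower_iff {H : Subgroup (Equiv.Perm ℝ)} (hH : ∀ g ∈ H, PLHomeo g)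
    (hB : BalancedOrbitals H) (n : ℕ) : (∃ a b, HasTower H (n + 1) a b) ↔ derivedIter H n ≠ ⊥ := by
  induction n generalizing H with
  | zero =>
    constructor
    · rintro ⟨a, b, hT⟩ hbot
      obtain ⟨g, hg, A⟩ := hT.exists_orbIoo
      obtain ⟨x, h1, h2⟩ := exists_between A.1
      rw [show H = ⊥ from hbot, Subgroup.mem_bot] at hg
      exact A.2.2.2 x h1 h2 (by rw [hg]; rfl)
    · intro hne
      obtain ⟨g, hg, hg1⟩ := (Subgroup.bot_or_exists_ne_one H).resolve_left hne
      obtain ⟨x, hx⟩ : ∃ x, g x ≠ x := by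
        by_contra! hc
        exact hg1 (Equiv.ext hc)
      obtain ⟨a, b, -, -, A⟩ := exists_orbIoo (hH g hg).1 hx
      exact ⟨a, b, .single hg A⟩
  | succ n ih =>
    rw [derivedIter, ← ih (fun g hg => hH g (commutator_le_self H hg))
      (hB.mono (commutator_le_self H))]
    constructor
    · rintro ⟨a, b, hT⟩
      cases hT with
      | cons hT hg A h1 h2 h3 => exact ⟨_, _, hT.commutator hH hB hg A h1 h2 h3⟩
    · rintro ⟨a, b, hT⟩
      exact hT.exists_of_commutator hH hB

/-! ### Comparison with towers of signed orbitals -/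

lemma HasTower.exists_isTower {H : Subgroup (Equiv.Perm ℝ)} {n : ℕ} {a b : ℝ}
    (h : HasTower H n a b) :
    ∃ T, IsTower H T ∧ T.Finite ∧ T.ncard = n ∧ ∀ r ∈ T, r.1 ⊆ Ioo a b := by
  induction h with
  | @single g a b hg A =>
    refine ⟨{(Ioo a b, g)}, ⟨?_, ?_, ?_⟩, finite_singleton _, ncard_singleton _, ?_⟩
    · rintro r rfl
      exact ⟨hg, A.isOrbital⟩
    · rintro r rfl s rfl
      exact Or.inl Subset.rfl
    · rintro r rfl s rfl -
      rfl
    · rintro r rfl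
      exact Subset.rfl
  | @cons n g a b c d hT hg C h1 h2 h3 ih =>
    obtain ⟨T, ⟨t1, t2, t3⟩, hfin, hcard, hsub⟩ := ih
    have hsub' : ∀ r ∈ T, r.1 ⊆ Ioo c d := fun r hr => (hsub r hr).trans (Ioo_subset_Ioo h1 h2)
    have hne : ∀ r ∈ T, r.1 ≠ Ioo c d := by
      intro r hr he
      have := hsub r hr
      rw [he, Ioo_subset_Ioo_iff C.1] at this
      rcases h3 with h3 | h3
      · exact absurd this.1 (not_le.2 h3)
      · exact absurd this.2 (not_le.2 h3)
    refine ⟨insert (Ioo c d, g) T, ⟨?_, ?_, ?_⟩, hfin.insert _, ?_, ?_⟩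
    · rintro r (rfl | hr)
      · exact ⟨hg, C.isOrbital⟩
      · exact t1 r hr
    · rintro r (rfl | hr) s (rfl | hs)
      · exact Or.inl Subset.rfl
      · exact Or.inr (hsub' s hs)
      · exact Or.inl (hsub' r hr)
      · exact t2 r hr s hs
    · rintro r (rfl | hr) s (rfl | hs) he
      · rfl
      · exact absurd he.symm (hne s hs)
      · exact absurd he (hne r hr)
      · exact t3 r hr s hs he
    · rw [ncard_insert_of_notMem (fun hmem => hne _ hmem rfl) hfin, hcard]
    · rintro r (rfl | hr)
      · exact Subset.rfl
      · exact hsub' r hr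

lemma IsTower.exists_hasTower {H : Subgroup (Equiv.Perm ℝ)} (hH : ∀ g ∈ H, Homeo01 g) (n : ℕ)
    {T : Set (Set ℝ × Equiv.Perm ℝ)} (hT : IsTower H T) (hfin : T.Finite)
    (hcard : T.ncard = n + 1) : ∃ a b, HasTower H (n + 1) a b ∧ ∃ g, (Ioo a b, g) ∈ T := by
  induction n generalizing T with
  | zero =>
    obtain ⟨⟨A, g⟩, rfl⟩ := ncard_eq_one.1 hcard
    obtain ⟨hg, ho⟩ := hT.1 _ rfl
    obtain ⟨a, b, hab, rfl⟩ := ho.exists_orbIoo (hH g hg)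
    exact ⟨a, b, .single hg hab, g, rfl⟩
  | succ n ih =>
    obtain ⟨⟨A, g⟩, hmem, hmax⟩ := hfin.exists_maximalFor (fun r => r.1) T
      (nonempty_of_ncard_ne_zero (by omega))
    obtain ⟨hg, ho⟩ := hT.1 _ hmem
    obtain ⟨c, d, C, rfl⟩ := ho.exists_orbIoo (hH g hg)
    obtain ⟨a, b, hT', g', hg'⟩ := ih (T := T \ {(Ioo c d, g)})
      ⟨fun r hr => hT.1 r hr.1, fun r hr s hs => hT.2.1 r hr.1 s hs.1,
        fun r hr s hs => hT.2.2 r hr.1 s hs.1⟩ hfin.sdiff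
      (by rw [ncard_sdiff_singleton_of_mem hmem, hcard]; rfl)
    obtain ⟨_, -, A⟩ := hT'.exists_orbIoo
    have hsub : Ioo a b ⊆ Ioo c d := by
      rcases hT.2.1 _ hg'.1 _ hmem with h | h
      · exact h
      · exact hmax hg'.1 h
    obtain ⟨h1, h2⟩ := (Ioo_subset_Ioo_iff A.1).1 hsub
    refine ⟨c, d, .cons hT' hg C h1 h2 ?_, g, hmem⟩
    by_contra! hc
    obtain rfl := le_antisymm h1 hc.1
    obtain rfl := le_antisymm h2 hc.2
    exact hg'.2 (hT.2.2 _ hg'.1 _ hmem rfl)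

lemma IsTower.mono {H : Subgroup (Equiv.Perm ℝ)} {S T : Set (Set ℝ × Equiv.Perm ℝ)}
    (hT : IsTower H T) (h : S ⊆ T) : IsTower H S :=
  ⟨fun r hr => hT.1 r (h hr), fun r hr s hs => hT.2.1 r (h hr) s (h hs),
    fun r hr s hs => hT.2.2 r (h hr) s (h hs)⟩

lemma exists_isTower_iff {H : Subgroup (Equiv.Perm ℝ)} (hH : ∀ g ∈ H, Homeo01 g) :
    (∀ n : ℕ, ∃ T, IsTower H T ∧ T.Finite ∧ n ≤ T.ncard) ↔
      ∀ n : ℕ, ∃ a b, HasTower H (n + 1) a b := by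
  constructor
  · intro h n
    obtain ⟨T, hT, hfin, hn⟩ := h (n + 1)
    obtain ⟨S, hST, hS⟩ := exists_subset_card_eq hn
    obtain ⟨a, b, h', -⟩ := (hT.mono hST).exists_hasTower hH n (hfin.subset hST) hS
    exact ⟨a, b, h'⟩
  · intro h n
    obtain ⟨a, b, hT⟩ := h n
    obtain ⟨T, h1, h2, h3, -⟩ := hT.exists_isTower
    exact ⟨T, h1, h2, by omega⟩

theorem stmt13 (H : Subgroup (Equiv.Perm ℝ)) (hH : ∀ g ∈ H, PLHomeo g) :
    ¬ IsSolvable ↥H ↔ ∀ n : ℕ, ∃ T, IsTower H T ∧ T.Finite ∧ n ≤ T.ncard := by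
  rw [exists_isTower_iff fun g hg => (hH g hg).1]
  refine (not_congr (isSolvable_iff_derivedIter H)).trans ?_
  push Not
  rcases balanced_or_exists_movesCompactly hH with hB | ⟨K, hKH, p, q, hK⟩
  · exact forall_congr' fun n => (hB.hasTower_iff hH n).symm
  · refine iff_of_true (hK.derivedIter_ne_bot (fun g hg => (hH g hg).1.1) hKH) fun n => ?_
    obtain ⟨a, b, -, -, hT⟩ := hK.hasTower (fun g hg => (hH g (hKH hg)).1) n
    exact ⟨a, b, hT.mono hKH⟩
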